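/- arXiv:0902.3643 — 2 statements merged into one kernel-verified Lean document; each statement's English description precedes it below -/
import Mathlib

section
/- Let ε = (ε₁, ε₂) be real numbers with ε₂ > 0 and ε₁ + ε₂ < -1. Then for every x = (x₁, x₂) ∈ ℝ², the spread option payoff satisfies P(x) = (2π)^{-2} ∫_{ℝ²} e^{i((v₁+iε₁)x₁ + (v₂+iε₂)x₂)} · P̂(v₁+iε₁, v₂+iε₂) dv₁ dv₂, where P̂(u₁,u₂) = Γ(i(u₁+u₂)-1)·Γ(-iu₂)/Γ(iu₁+1). -/
open MeasureTheory

namespace SpreadAux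
open Complex Set FourierTransform

theorem plancherel {g : ℝ → ℂ} (hc : Continuous g) (hg : Integrable g) (hF : Integrable (𝓕 g)) :
    Integrable (fun x => ‖𝓕 g x‖ ^ 2) ∧ ∫ x, ‖𝓕 g x‖ ^ 2 = ∫ x, ‖g x‖ ^ 2 := by
  constructor
  · have hb : ∀ x, ‖𝓕 g x‖ ≤ ∫ v, ‖g v‖ := fun x => by
      rw [Real.fourier_eq]
      apply (norm_integral_le_integral_norm _).trans
      simp_rw [Circle.norm_smul]
      exact le_rfl
    have : Integrable (fun x => ‖𝓕 g x‖ * ‖𝓕 g x‖) := by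
      refine hF.norm.bdd_mul (c := ∫ v, ‖g v‖) hF.norm.aestronglyMeasurable ?_
      filter_upwards with x
      simpa using hb x
    simpa [sq] using this
  · have h := VectorFourier.integral_sesq_fourierIntegral_eq_neg_flip (innerSL ℂ (E := ℂ))
      (L := innerₗ ℝ) Real.continuous_fourierChar continuous_inner hg hF
    have h2 : ∀ x, VectorFourier.fourierIntegral Real.fourierChar volume (-(innerₗ ℝ).flip) (𝓕 g) x
        = g x := by
      intro x
      have := congrFun (hc.fourierInv_fourier_eq hg hF) x
      simpa [Real.fourierInv_eq, VectorFourier.fourierIntegral] using this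
    simp only [h2] at h
    have h3 : ∫ x, (inner ℂ (𝓕 g x) (𝓕 g x)) = ∫ x, (inner ℂ (g x) (g x)) := h
    simp only [inner_self_eq_norm_sq_to_K] at h3
    apply Complex.ofReal_injective
    rw [← integral_complex_ofReal, ← integral_complex_ofReal]
    simpa using h3

theorem mellin_l2 (σ : ℝ) (f : ℝ → ℂ) (hf : MellinConvergent f σ)
    (hFf : VerticalIntegrable (mellin f) σ) (hc : ContinuousOn f (Ioi 0)) :
    Integrable (fun t : ℝ => ‖mellin f (σ + t * I)‖ ^ 2) ∧
    ∫ t : ℝ, ‖mellin f (σ + t * I)‖ ^ 2 =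
      2 * Real.pi * ∫ u : ℝ, (Real.exp (-σ * u) * ‖f (Real.exp (-u))‖) ^ 2 := by
  let g := fun (u : ℝ) => Real.exp (-σ * u) • f (Real.exp (-u))
  have him : (fun u : ℝ => Real.exp (-u)) '' univ = Ioi 0 := by
    ext y
    simp only [image_univ, mem_range, mem_Ioi]
    constructor
    · rintro ⟨u, rfl⟩; positivity
    · intro hy; exact ⟨-Real.log y, by simp [Real.exp_log hy]⟩
  have hd : ∀ x ∈ (univ : Set ℝ), HasDerivWithinAt (fun u : ℝ => Real.exp (-u)) (-Real.exp (-x)) univ x := by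
    intro x _
    have := ((Real.hasDerivAt_exp (-x)).comp x (hasDerivAt_neg x)).hasDerivWithinAt (s := univ)
    simpa [Function.comp_def] using this
  have hinj : InjOn (fun u : ℝ => Real.exp (-u)) univ := by
    intro a _ b _ h; simpa using h
  have hg : Integrable g := by
    rw [MellinConvergent, ← him, integrableOn_image_iff_integrableOn_abs_deriv_smul
      MeasurableSet.univ hd hinj] at hf
    rw [integrableOn_univ] at hf
    convert hf using 2 with u
    simp only [g, abs_neg, abs_of_pos (Real.exp_pos (-u))]
    rw [← smul_assoc]
    simp only [real_smul, smul_eq_mul]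
    congr 1
    rw [Complex.cpow_def_of_ne_zero (by simp), ← Complex.ofReal_log (by positivity), Real.log_exp]
    push_cast
    rw [← Complex.exp_add]; ring_nf
  have hm : ∀ t : ℝ, mellin f (σ + t * I) = 𝓕 g (t / (2 * Real.pi)) := by
    intro t
    rw [mellin_eq_fourier]; simp [g]
  have h2π : (2 * Real.pi) ≠ 0 := by positivity
  have hF : Integrable (𝓕 g) := by
    have h := hFf
    unfold VerticalIntegrable at h
    simp only [hm] at h
    have := h.comp_mul_right' h2π
    simpa [mul_div_cancel_right₀ _ h2π] using this
  have hgc : Continuous g := by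
    have : Continuous fun u : ℝ => f (Real.exp (-u)) :=
      hc.comp_continuous (by fun_prop) (fun u => Real.exp_pos _)
    have h0 : Continuous fun u : ℝ => Real.exp (-σ * u) := by fun_prop
    exact h0.smul this
  obtain ⟨h1, h2⟩ := plancherel hgc hg hF
  simp only [hm]
  refine ⟨h1.comp_div h2π, ?_⟩
  rw [Measure.integral_comp_div (fun x => ‖𝓕 g x‖ ^ 2), h2, abs_of_pos (by positivity)]
  simp only [g, norm_smul, Real.norm_eq_abs, Real.abs_exp, smul_eq_mul]

/-- Beta-type function. -/
noncomputable def BB (z b : ℂ) : ℂ := Gamma b * Gamma (z - b) / Gamma z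

noncomputable def Phi (z : ℂ) (r : ℝ) : ℂ := ((1 + r : ℝ) : ℂ) ^ (-z)

theorem mellin_Phi {z b : ℂ} (hb : 0 < b.re) (hzb : b.re < z.re) :
    HasMellin (Phi z) b (BB z b) := by
  have hzb' : 0 < (z - b).re := by simpa using hzb
  have him : (fun x : ℝ => x / (1 - x)) '' Ioo 0 1 = Ioi 0 := by
    ext y
    simp only [mem_image, mem_Ioo, mem_Ioi]
    constructor
    · rintro ⟨x, ⟨h0, h1⟩, rfl⟩
      exact div_pos h0 (by linarith)
    · intro hy
      refine ⟨y / (1 + y), ⟨by positivity, ?_⟩, ?_⟩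
      · rw [div_lt_one (by positivity)]; linarith
      · field_simp; ring
  have hd : ∀ x ∈ Ioo (0:ℝ) 1, HasDerivWithinAt (fun x : ℝ => x / (1 - x)) (1 / (1 - x) ^ 2) (Ioo 0 1) x := by
    intro x hx
    have h1 : 1 - x ≠ 0 := by linarith [hx.2]
    have h2 : HasDerivAt (fun x : ℝ => x / (1 - x)) ((1 * (1 - x) - x * (-1)) / (1 - x) ^ 2) x :=
      HasDerivAt.fun_div (hasDerivAt_id' x) ((hasDerivAt_id' x).const_sub 1) h1
    rw [show (1 * (1 - x) - x * (-1)) = 1 by ring] at h2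
    exact h2.hasDerivWithinAt
  have hinj : InjOn (fun x : ℝ => x / (1 - x)) (Ioo 0 1) := by
    intro a ha b hb h
    have h1 : 1 - a ≠ 0 := by linarith [ha.2]
    have h2 : 1 - b ≠ 0 := by linarith [hb.2]
    replace h : a / (1 - a) = b / (1 - b) := h
    rw [div_eq_div_iff h1 h2] at h
    linarith
  have hpt : ∀ x ∈ Ioo (0:ℝ) 1, |1 / (1 - x) ^ 2| • ((x / (1 - x) : ℝ) : ℂ) ^ (b - 1) • Phi z (x / (1 - x))
      = (x : ℂ) ^ (b - 1) * (1 - (x : ℂ)) ^ (z - b - 1) := by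
    intro x hx
    have hx0 := hx.1
    have h1 : 0 < 1 - x := by linarith [hx.2]
    have e : 1 + x / (1 - x) = (1 - x)⁻¹ := by field_simp; ring
    have hxl : (1 - (x:ℂ)) = ((1 - x : ℝ) : ℂ) := by push_cast; rfl
    unfold Phi
    rw [e, abs_of_pos (by positivity), hxl]
    have c1 : ((x / (1 - x) : ℝ) : ℂ) ≠ 0 := by exact_mod_cast (div_pos hx0 h1).ne'
    have c2 : (((1 - x)⁻¹ : ℝ) : ℂ) ≠ 0 := by exact_mod_cast (inv_pos.2 h1).ne'
    have c3 : ((1 - x : ℝ) : ℂ) ≠ 0 := by exact_mod_cast h1.ne'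
    have c4 : (x : ℂ) ≠ 0 := by exact_mod_cast hx0.ne'
    have e2 : (1 / (1 - x) ^ 2) = Real.exp (-2 * Real.log (1 - x)) := by
      rw [mul_comm, ← Real.rpow_def_of_pos h1, Real.rpow_neg h1.le]
      norm_num
    rw [e2, real_smul, smul_eq_mul, cpow_def_of_ne_zero c1, cpow_def_of_ne_zero c2,
      cpow_def_of_ne_zero c3, cpow_def_of_ne_zero c4, ← ofReal_log (by positivity),
      ← ofReal_log (by positivity), ← ofReal_log (by positivity), ← ofReal_log (by positivity),
      Real.log_div hx0.ne' h1.ne', Real.log_inv, ofReal_exp, ← Complex.exp_add, ← Complex.exp_add,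
      ← Complex.exp_add]
    push_cast
    ring_nf
  constructor
  · rw [MellinConvergent, ← him, integrableOn_image_iff_integrableOn_abs_deriv_smul
      measurableSet_Ioo hd hinj]
    have := betaIntegral_convergent hb hzb'
    rw [intervalIntegrable_iff_integrableOn_Ioo_of_le zero_le_one] at this
    exact this.congr_fun (fun x hx => (hpt x hx).symm) measurableSet_Ioo
  · rw [mellin, ← him, integral_image_eq_integral_abs_deriv_smul measurableSet_Ioo hd hinj,
      setIntegral_congr_fun measurableSet_Ioo hpt, ← integral_Ioc_eq_integral_Ioo,
      ← intervalIntegral.integral_of_le zero_le_one]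
    have := betaIntegral_eq_Gamma_mul_div b (z - b) hb hzb'
    rw [betaIntegral] at this
    rw [this, BB]; simp

theorem norm_Phi (z : ℂ) {r : ℝ} (hr : 0 < r) : ‖Phi z r‖ = (1 + r) ^ (-z.re) := by
  unfold Phi
  rw [norm_cpow_eq_rpow_re_of_pos (by positivity)]; simp

theorem continuousOn_Phi (z : ℂ) : ContinuousOn (Phi z) (Ioi 0) := by
  intro r hr
  have hr : 0 < r := hr
  unfold Phi
  refine ContinuousAt.continuousWithinAt ?_
  refine ContinuousAt.cpow (by fun_prop) (by fun_prop) ?_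
  left
  simp only [ofReal_re]
  positivity

theorem BB_rec {z b : ℂ} (hz : z ≠ 0) (hb : b ≠ 0) : b * BB z b = z * BB (z + 1) (b + 1) := by
  unfold BB
  rw [Gamma_add_one _ hz, Gamma_add_one _ hb, show z + 1 - (b + 1) = z - b by ring]
  by_cases h : Gamma z = 0
  · simp [h]
  · field_simp

theorem BB_bdd {z b : ℂ} (hb : 0 < b.re) (hzb : b.re < z.re) :
    ‖BB z b‖ ≤ ∫ r in Ioi (0:ℝ), r ^ (b.re - 1) * (1 + r) ^ (-z.re) := by
  rw [← (mellin_Phi hb hzb).2, mellin]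
  refine (norm_integral_le_integral_norm _).trans (le_of_eq ?_)
  refine setIntegral_congr_fun measurableSet_Ioi ?_
  intro r hr
  have hr : 0 < r := hr
  simp only [norm_smul]
  rw [norm_Phi _ hr, norm_cpow_eq_rpow_re_of_pos hr]; simp

theorem continuous_BB {X : Type*} [TopologicalSpace X] {z b : X → ℂ} (hz : Continuous z)
    (hbc : Continuous b) (hb : ∀ x, 0 < (b x).re) (hzb : ∀ x, (b x).re < (z x).re) :
    Continuous fun x => BB (z x) (b x) := by
  have key : ∀ f : X → ℂ, Continuous f → (∀ x, 0 < (f x).re) → Continuous fun x => Gamma (f x) := by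
    intro f hf h
    rw [continuous_iff_continuousAt]
    intro x
    refine ContinuousAt.comp (g := Gamma) ?_ hf.continuousAt
    refine (differentiableAt_Gamma _ ?_).continuousAt
    intro m hm
    have := h x
    rw [hm] at this
    simp at this
    have h2 : (0:ℝ) ≤ m := Nat.cast_nonneg m
    linarith
  unfold BB
  refine ((key b hbc hb).mul (key _ (hz.sub hbc) ?_)).div (key z hz ?_) ?_
  · intro x; simpa using hzb x
  · intro x; exact (hb x).trans (hzb x)
  · intro x; exact Gamma_ne_zero_of_re_pos ((hb x).trans (hzb x))

theorem vert_integrable_BB {z : ℂ} {β : ℝ} (hb : 0 < β) (hzb : β < z.re) :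
    Integrable fun t : ℝ => BB z (β + t * I) := by
  have hcont : Continuous fun t : ℝ => BB z (β + t * I) :=
    continuous_BB continuous_const (by fun_prop) (by simp [hb]) (by simpa using hzb)
  have hz : 0 < z.re := hb.trans hzb
  have hz0 : z ≠ 0 := by rintro rfl; simp at hz
  have hz1 : z + 1 ≠ 0 := by
    intro h; have := congrArg re h; simp at this; linarith
  obtain ⟨M, hM⟩ : ∃ M, ∀ t : ℝ, ‖BB (z + 1 + 1) (β + t * I + 1 + 1)‖ ≤ M := by
    refine ⟨∫ r in Ioi (0:ℝ), r ^ (β + 1 + 1 - 1) * (1 + r) ^ (-(z.re + 1 + 1)),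
      fun t => (BB_bdd (by simp; linarith) (by simp; linarith)).trans (le_of_eq ?_)⟩
    simp
  have hint : Integrable fun t : ℝ => (‖z‖ * ‖z + 1‖ * M * (1 + (β⁻¹)^2)) * (1 + t ^ 2)⁻¹ :=
    integrable_inv_one_add_sq.const_mul _
  refine hint.mono' hcont.aestronglyMeasurable ?_
  filter_upwards with t
  set b : ℂ := β + t * I with hbdef
  have hbre : b.re = β := by simp [hbdef]
  have hbim : b.im = t := by simp [hbdef]
  have hb0 : b ≠ 0 := by intro h; rw [h] at hbre; simp at hbre; linarith
  have hb1 : b + 1 ≠ 0 := by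
    intro h; have := congrArg re h; simp [hbre] at this; linarith
  have h1 := BB_rec hz0 hb0
  have h2 := BB_rec hz1 hb1
  have h3 : b * (b + 1) * BB z b = z * (z + 1) * BB (z + 1 + 1) (b + 1 + 1) := by
    linear_combination (b + 1) * h1 + z * h2
  have h4 := congrArg norm h3
  simp only [norm_mul] at h4
  have h5 : ‖b‖ ^ 2 = β ^ 2 + t ^ 2 := by
    rw [← normSq_eq_norm_sq, normSq_apply, hbre, hbim]; ring
  have h6 : ‖b‖ ≤ ‖b + 1‖ := by
    have : ‖b‖ ^ 2 ≤ ‖b + 1‖ ^ 2 := by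
      rw [← normSq_eq_norm_sq, ← normSq_eq_norm_sq, normSq_apply, normSq_apply]
      simp [hbre, hbim]; nlinarith
    exact le_of_sq_le_sq this (norm_nonneg _)
  have h7 : (β ^ 2 + t ^ 2) * ‖BB z b‖ ≤ ‖z‖ * ‖z + 1‖ * M := by
    calc (β ^ 2 + t ^ 2) * ‖BB z b‖ = ‖b‖ * ‖b‖ * ‖BB z b‖ := by rw [← h5]; ring
      _ ≤ ‖b‖ * ‖b + 1‖ * ‖BB z b‖ := by gcongr
      _ = _ := h4
      _ ≤ _ := by gcongr; exact hM t
  have hp : 0 ≤ ‖z‖ * ‖z + 1‖ * M := le_trans (by positivity) h7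
  have h8 : ‖BB z b‖ ≤ (‖z‖ * ‖z + 1‖ * M) / (β ^ 2 + t ^ 2) := by
    rw [le_div_iff₀ (by positivity)]; linarith
  refine h8.trans ?_
  rw [mul_assoc _ (1 + β⁻¹ ^ 2), div_eq_mul_inv]
  refine mul_le_mul_of_nonneg_left ?_ hp
  rw [← div_eq_mul_inv, inv_eq_one_div, div_le_div_iff₀ (by positivity) (by positivity)]
  have : (1 + β⁻¹ ^ 2) * (β ^ 2 + t ^ 2) = 1 + t ^ 2 + β ^ 2 + β⁻¹ ^ 2 * t ^ 2 := by
    field_simp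
    ring
  rw [this]
  nlinarith [mul_nonneg (sq_nonneg β⁻¹) (sq_nonneg t), sq_nonneg β]

theorem l2_BB {β c : ℝ} (hb : 0 < β) (hc : β < c) : ∃ C : ℝ, 0 ≤ C ∧ ∀ z : ℂ, z.re = c →
    Integrable (fun t : ℝ => ‖BB z (β + t * I)‖ ^ 2) ∧ ∫ t : ℝ, ‖BB z (β + t * I)‖ ^ 2 ≤ C := by
  refine ⟨2 * Real.pi * ∫ u : ℝ, (Real.exp (-β * u) * (1 + Real.exp (-u)) ^ (-c)) ^ 2, ?_, ?_⟩
  · have : 0 ≤ ∫ u : ℝ, (Real.exp (-β * u) * (1 + Real.exp (-u)) ^ (-c)) ^ 2 :=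
      integral_nonneg fun u => sq_nonneg _
    positivity
  · intro z hz
    have hm : ∀ t : ℝ, mellin (Phi z) (β + t * I) = BB z (β + t * I) := fun t =>
      (mellin_Phi (by simp [hb]) (by simp [hz, hc])).2
    have h := mellin_l2 β (Phi z) (mellin_Phi (by simp [hb]) (by simp [hz, hc])).1
      (by unfold VerticalIntegrable; simp only [hm]; exact vert_integrable_BB hb (by rw [hz]; exact hc))
      (continuousOn_Phi z)
    simp only [hm] at h
    refine ⟨h.1, h.2.trans_le (le_of_eq ?_)⟩
    congr 2
    ext u
    rw [norm_Phi _ (Real.exp_pos _), hz]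

theorem integral_cauchy {l : ℝ} (hl : 0 < l) :
    Integrable (fun t : ℝ => (l ^ 2 + t ^ 2)⁻¹) ∧ ∫ t : ℝ, (l ^ 2 + t ^ 2)⁻¹ = Real.pi / l := by
  have e : ∀ t : ℝ, (l ^ 2 + t ^ 2)⁻¹ = (l ^ 2)⁻¹ * (1 + (t / l) ^ 2)⁻¹ := by
    intro t
    rw [← mul_inv]; congr 1; field_simp
  simp only [e]
  refine ⟨(integrable_inv_one_add_sq.comp_div hl.ne').const_mul _, ?_⟩
  rw [integral_const_mul, Measure.integral_comp_div (fun t : ℝ => (1 + t ^ 2)⁻¹),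
    integral_univ_inv_one_add_sq, abs_of_pos hl, smul_eq_mul]
  field_simp

theorem l1_BB {β c : ℝ} (hb : 0 < β) (hc : β < c) : ∃ K : ℝ, 0 ≤ K ∧ ∀ z : ℂ, z.re = c →
    ∫ t : ℝ, ‖BB z (β + t * I)‖ ≤ K * ‖z‖ ^ (1 / 2 : ℝ) := by
  obtain ⟨C₁, hC₁, h1⟩ := l2_BB hb hc
  obtain ⟨C₂, hC₂, h2⟩ := l2_BB (β := β + 1) (c := c + 1) (by linarith) (by linarith)
  refine ⟨(Real.pi + C₁ + C₂) / 2, by positivity, ?_⟩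
  intro z hz
  obtain ⟨i1, e1⟩ := h1 z hz
  obtain ⟨i2, e2⟩ := h2 (z + 1) (by simp [hz])
  have hz0 : z ≠ 0 := by rintro rfl; simp at hz; linarith
  have hl : 0 < ‖z‖ := norm_pos_iff.2 hz0
  obtain ⟨i3, e3⟩ := integral_cauchy hl
  set m : ℝ := ‖z‖ ^ (1 / 2 : ℝ) with hm
  have hmpos : 0 < m := by positivity
  have hm2 : m ^ 2 = ‖z‖ := by
    rw [hm, ← Real.rpow_natCast, ← Real.rpow_mul hl.le]; norm_num
  have hpt : ∀ t : ℝ, ‖BB z (β + t * I)‖ ≤ (1 / 2) * (m ^ 3 * (‖z‖ ^ 2 + t ^ 2)⁻¹ +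
      (m * ‖BB z (β + t * I)‖ ^ 2 + m * ‖BB (z + 1) ((β + 1 : ℝ) + t * I)‖ ^ 2)) := by
    intro t
    have hb0 : (β + t * I : ℂ) ≠ 0 := by
      intro h; have := congrArg re h; simp at this; linarith
    have hr := congrArg norm (BB_rec hz0 hb0)
    rw [show (β + t * I + 1 : ℂ) = ((β + 1 : ℝ) + t * I) by push_cast; ring] at hr
    simp only [norm_mul] at hr
    have hbn : t ^ 2 ≤ ‖(β + t * I : ℂ)‖ ^ 2 := by
      rw [← normSq_eq_norm_sq, normSq_apply]; simp; nlinarith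
    set X := ‖BB z (β + t * I)‖
    set Y := ‖BB (z + 1) ((β + 1 : ℝ) + t * I)‖
    set B := ‖(β + t * I : ℂ)‖
    have h5 : t ^ 2 * X ^ 2 ≤ ‖z‖ ^ 2 * Y ^ 2 := by
      calc t ^ 2 * X ^ 2 ≤ B ^ 2 * X ^ 2 := by gcongr
        _ = (B * X) ^ 2 := by ring
        _ = _ := by rw [hr]; ring
    set D := ‖z‖ ^ 2 + t ^ 2 with hD
    have hDpos : 0 < D := by positivity
    have h6 : D * X ^ 2 ≤ m ^ 4 * (X ^ 2 + Y ^ 2) := by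
      rw [show m ^ 4 = ‖z‖ ^ 2 by rw [← hm2]; ring]
      rw [hD]; linarith
    have h7 : X ≤ (1 / 2) * (m ^ 3 * D⁻¹ + D * X ^ 2 / m ^ 3) := by
      have : (1 / 2) * (m ^ 3 * D⁻¹ + D * X ^ 2 / m ^ 3) - X = (m ^ 3 - D * X) ^ 2 / (2 * D * m ^ 3) := by
        field_simp; ring
      have h8 : 0 ≤ (m ^ 3 - D * X) ^ 2 / (2 * D * m ^ 3) := by positivity
      linarith
    have h9 : D * X ^ 2 / m ^ 3 ≤ m * X ^ 2 + m * Y ^ 2 := by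
      rw [div_le_iff₀ (by positivity)]
      calc _ ≤ _ := h6
        _ = _ := by ring
    linarith
  have hint := ((i3.const_mul (m ^ 3)).fun_add ((i1.const_mul m).fun_add (i2.const_mul m))).const_mul (1 / 2)
  have hle := integral_mono (vert_integrable_BB hb (by rw [hz]; exact hc)).norm hint hpt
  refine hle.trans ?_
  rw [integral_const_mul, integral_add (i3.const_mul _) ((i1.const_mul m).fun_add (i2.const_mul m)),
    integral_add (i1.const_mul m) (i2.const_mul m), integral_const_mul, integral_const_mul, integral_const_mul, e3]
  have e4 : m ^ 3 * (Real.pi / ‖z‖) = m * Real.pi := by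
    rw [← hm2]; field_simp
  rw [e4]
  nlinarith [mul_le_mul_of_nonneg_left e1 hmpos.le, mul_le_mul_of_nonneg_left e2 hmpos.le]

noncomputable def kk (q : ℝ) : ℂ := ((max (1 - q) 0 : ℝ) : ℂ)

theorem mellin_kk {z : ℂ} (hz : 0 < z.re) : HasMellin kk z (1 / (z * (z + 1))) := by
  have h1 := hasMellin_one_Ioc hz
  have h2 := hasMellin_cpow_Ioc 1 (s := z) (by simp; linarith)
  have h3 := hasMellin_sub h1.1 h2.1
  have hz0 : z ≠ 0 := by rintro rfl; simp at hz
  have hz1 : z + 1 ≠ 0 := by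
    intro h; have := congrArg re h; simp at this; linarith
  have hpt : ∀ t ∈ Ioi (0:ℝ), (t : ℂ) ^ (z - 1) • (indicator (Ioc 0 1) (fun _ => 1 : ℝ → ℂ) t -
      indicator (Ioc 0 1) (fun t => (t : ℂ) ^ (1 : ℂ) : ℝ → ℂ) t) = (t : ℂ) ^ (z - 1) • kk t := by
    intro t ht
    have ht : 0 < t := ht
    congr 1
    by_cases h : t ≤ 1
    · have h' : t ∈ Ioc (0:ℝ) 1 := ⟨ht, h⟩
      rw [indicator_of_mem h', indicator_of_mem h', kk, max_eq_left (by linarith)]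
      simp
    · have h' : t ∉ Ioc (0:ℝ) 1 := fun hh => h hh.2
      rw [indicator_of_notMem h', indicator_of_notMem h', kk, max_eq_right (by linarith)]
      simp
  constructor
  · exact IntegrableOn.congr_fun h3.1 hpt measurableSet_Ioi
  · rw [mellin, ← setIntegral_congr_fun measurableSet_Ioi hpt]
    have := h3.2
    rw [h1.2, h2.2] at this
    rw [mellin] at this
    rw [this]
    field_simp
    ring

theorem norm_ge_aux {c w : ℝ} (hc : 0 < c) : min c 1 / 2 * (1 + |w|) ≤ ‖(c + w * I : ℂ)‖ := by
  have h1 : |c| ≤ ‖(c + w * I : ℂ)‖ := by simpa using abs_re_le_norm (c + w * I : ℂ)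
  have h2 : |w| ≤ ‖(c + w * I : ℂ)‖ := by simpa using abs_im_le_norm (c + w * I : ℂ)
  rw [abs_of_pos hc] at h1
  have h3 := min_le_left c 1
  have h4 := min_le_right c 1
  nlinarith [abs_nonneg w]

theorem norm_le_add_one {z : ℂ} (hz : 0 < z.re) : ‖z‖ ≤ ‖z + 1‖ := by
  have : ‖z‖ ^ 2 ≤ ‖z + 1‖ ^ 2 := by
    rw [← normSq_eq_norm_sq, ← normSq_eq_norm_sq, normSq_apply, normSq_apply]
    simp; nlinarith
  exact le_of_sq_le_sq this (norm_nonneg _)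

theorem integrable_outer {c : ℝ} (hc : 0 < c) :
    Integrable fun w : ℝ => ‖(c + w * I : ℂ)‖ ^ (1 / 2 : ℝ) / (‖(c + w * I : ℂ)‖ * ‖(c + w * I + 1 : ℂ)‖) := by
  have hne : ∀ w : ℝ, (c + w * I : ℂ) ≠ 0 := fun w h => by
    have := congrArg re h; simp at this; linarith
  have hne1 : ∀ w : ℝ, (c + w * I + 1 : ℂ) ≠ 0 := fun w h => by
    have := congrArg re h; simp at this; linarith
  have hi := (integrable_one_add_norm (E := ℝ) (μ := volume) (r := 3 / 2) (by norm_num)).const_mul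
    ((min c 1 / 2) ^ (-(3 / 2) : ℝ))
  refine hi.mono' ?_ ?_
  · refine Continuous.aestronglyMeasurable ?_
    refine Continuous.div ?_ (by fun_prop) ?_
    · exact Continuous.rpow_const (by fun_prop) (fun w => Or.inr (by norm_num))
    · intro w; exact mul_ne_zero (norm_ne_zero_iff.2 (hne w)) (norm_ne_zero_iff.2 (hne1 w))
  · filter_upwards with w
    have hz : 0 < ‖(c + w * I : ℂ)‖ := norm_pos_iff.2 (hne w)
    have h1 : ‖(c + w * I : ℂ)‖ ≤ ‖(c + w * I + 1 : ℂ)‖ := norm_le_add_one (by simpa using hc)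
    have h2 := norm_ge_aux (w := w) hc
    set l := ‖(c + w * I : ℂ)‖
    have hm : 0 < min c 1 / 2 := by positivity
    rw [Real.norm_of_nonneg (by positivity), Real.norm_eq_abs, ← Real.mul_rpow hm.le (by positivity)]
    calc l ^ (1 / 2 : ℝ) / (l * ‖(c + w * I + 1 : ℂ)‖) ≤ l ^ (1 / 2 : ℝ) / (l * l) := by gcongr
      _ = l ^ (-(3 / 2) : ℝ) := by
        rw [show (-(3/2) : ℝ) = 1 / 2 - 2 by norm_num, Real.rpow_sub hz]
        norm_num [sq]
      _ ≤ _ := Real.rpow_le_rpow_of_nonpos (by positivity) h2 (by norm_num)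

theorem inner_eq {z : ℂ} {β : ℝ} (hb : 0 < β) (hzb : β < z.re) (x₂ : ℝ) :
    ∫ t : ℝ, cexp (-(β + t * I) * x₂) * BB z (β + t * I) = 2 * Real.pi * Phi z (Real.exp x₂) := by
  have hm : ∀ t : ℝ, mellin (Phi z) (β + t * I) = BB z (β + t * I) := fun t =>
    (mellin_Phi (by simp [hb]) (by simp [hzb])).2
  have h := mellinInv_mellin_eq β (Phi z) (Real.exp_pos x₂)
    (mellin_Phi (by simp [hb]) (by simp [hzb])).1
    (by unfold VerticalIntegrable; simp only [hm]; exact vert_integrable_BB hb hzb)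
    ((continuousOn_Phi z).continuousAt (Ioi_mem_nhds (Real.exp_pos x₂)))
  rw [← h, mellinInv]
  simp only [hm]
  have e : ∀ t : ℝ, ((Real.exp x₂ : ℝ) : ℂ) ^ (-(β + t * I : ℂ)) = cexp (-(β + t * I) * x₂) := by
    intro t
    rw [cpow_def_of_ne_zero (by simp), ← ofReal_log (by positivity), Real.log_exp, mul_comm]
  simp only [e, smul_eq_mul, real_smul]
  rw [← mul_assoc]
  have e0 : (2 * Real.pi : ℂ) * ((1 / (2 * Real.pi) : ℝ) : ℂ) = 1 := by
    have : (Real.pi : ℂ) ≠ 0 := by exact_mod_cast Real.pi_ne_zero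
    push_cast
    field_simp
  rw [e0, one_mul]

theorem outer_eq {c q : ℝ} (hc : 0 < c) (hq : 0 < q) :
    ∫ w : ℝ, (q : ℂ) ^ (-(c + w * I : ℂ)) * (1 / ((c + w * I) * (c + w * I + 1))) =
      2 * Real.pi * kk q := by
  have hm : ∀ t : ℝ, mellin kk (c + t * I) = (1 / ((c + t * I) * (c + t * I + 1))) := fun t =>
    (mellin_kk (by simp [hc])).2
  have hne : ∀ w : ℝ, (c + w * I : ℂ) ≠ 0 := fun w h => by
    have := congrArg re h; simp at this; linarith
  have hne1 : ∀ w : ℝ, (c + w * I + 1 : ℂ) ≠ 0 := fun w h => by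
    have := congrArg re h; simp at this; linarith
  have hv : VerticalIntegrable (mellin kk) c := by
    unfold VerticalIntegrable
    simp only [hm]
    refine ((integrable_outer hc).const_mul (c ^ (-(1 / 2) : ℝ))).mono' ?_ ?_
    · refine Continuous.aestronglyMeasurable ?_
      exact Continuous.div (by fun_prop) (by fun_prop) fun w => mul_ne_zero (hne w) (hne1 w)
    · filter_upwards with w
      have h1 : |c| ≤ ‖(c + w * I : ℂ)‖ := by simpa using abs_re_le_norm (c + w * I : ℂ)
      rw [abs_of_pos hc] at h1
      rw [norm_div, norm_mul, norm_one, ← mul_div_assoc]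
      gcongr
      rw [Real.rpow_neg hc.le, ← div_eq_inv_mul, le_div_iff₀ (by positivity), one_mul]
      gcongr
  have h := mellinInv_mellin_eq c kk hq (mellin_kk (by simp [hc])).1 hv
    (by unfold kk; fun_prop)
  rw [← h, mellinInv]
  simp only [hm, smul_eq_mul, real_smul]
  rw [← mul_assoc]
  have e0 : (2 * Real.pi : ℂ) * ((1 / (2 * Real.pi) : ℝ) : ℂ) = 1 := by
    have : (Real.pi : ℂ) ≠ 0 := by exact_mod_cast Real.pi_ne_zero
    push_cast
    field_simp
  rw [e0, one_mul]

noncomputable def HH (c β x₁ x₂ w t : ℝ) : ℂ :=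
  (cexp ((c + w * I + 1) * x₁) / ((c + w * I) * (c + w * I + 1))) *
    (cexp (-(β + t * I) * x₂) * BB (c + w * I) (β + t * I))

theorem norm_HH (c β x₁ x₂ w t : ℝ) : ‖HH c β x₁ x₂ w t‖ =
    (Real.exp ((c + 1) * x₁) * Real.exp (-β * x₂) / (‖(c + w * I : ℂ)‖ * ‖(c + w * I + 1 : ℂ)‖)) *
      ‖BB (c + w * I) (β + t * I)‖ := by
  unfold HH
  rw [norm_mul, norm_mul, norm_div, norm_mul, norm_exp, norm_exp]
  have e1 : ((c + w * I + 1) * x₁ : ℂ).re = (c + 1) * x₁ := by simp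
  have e2 : (-(β + t * I) * x₂ : ℂ).re = -β * x₂ := by simp
  rw [e1, e2]
  ring

theorem integrable_HH {c β : ℝ} (hb : 0 < β) (hc : β < c) (x₁ x₂ : ℝ) :
    Integrable (fun v : ℝ × ℝ => HH c β x₁ x₂ v.1 (-v.2)) (volume.prod volume) := by
  have hc0 : 0 < c := hb.trans hc
  have hne : ∀ w : ℝ, (c + w * I : ℂ) ≠ 0 := fun w h => by
    have := congrArg re h; simp at this; linarith
  have hne1 : ∀ w : ℝ, (c + w * I + 1 : ℂ) ≠ 0 := fun w h => by
    have := congrArg re h; simp at this; linarith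
  have hcont : Continuous (fun v : ℝ × ℝ => HH c β x₁ x₂ v.1 (-v.2)) := by
    unfold HH
    refine Continuous.mul (Continuous.div (by fun_prop) (by fun_prop)
      fun v => mul_ne_zero (hne _) (hne1 _)) (Continuous.mul (by fun_prop) ?_)
    exact continuous_BB (by fun_prop) (by fun_prop) (by simp [hb]) (by simp [hc])
  obtain ⟨K, hK0, hK⟩ := l1_BB hb hc
  rw [integrable_prod_iff hcont.aestronglyMeasurable]
  have hre : ∀ w : ℝ, (c + w * I : ℂ).re = c := by simp
  constructor
  · filter_upwards with w
    have hp : Continuous fun t : ℝ => (w, t) := by fun_prop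
    have hcw : Continuous fun t : ℝ => HH c β x₁ x₂ w (-t) := by
      have h0 := hcont.comp hp
      simpa only [Function.comp_def] using h0
    rw [← integrable_norm_iff hcw.aestronglyMeasurable]
    simp only [norm_HH]
    have := (vert_integrable_BB (z := c + w * I) hb (by rw [hre]; exact hc)).norm.comp_neg
    exact this.const_mul _
  · refine ((integrable_outer hc0).const_mul
      (Real.exp ((c + 1) * x₁) * Real.exp (-β * x₂) * K)).mono' ?_ ?_
    · exact (hcont.norm.aestronglyMeasurable (μ := volume.prod volume)).integral_prod_right'
    · filter_upwards with w
      rw [Real.norm_of_nonneg (integral_nonneg fun t => norm_nonneg _)]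
      simp only [norm_HH]
      rw [integral_const_mul, integral_neg_eq_self (fun t : ℝ => ‖BB (c + w * I) (β + t * I)‖)]
      have h := hK (c + w * I) (hre w)
      have h2 : 0 ≤ Real.exp ((c + 1) * x₁) * Real.exp (-β * x₂) / (‖(c + w * I : ℂ)‖ * ‖(c + w * I + 1 : ℂ)‖) := by
        positivity
      refine (mul_le_mul_of_nonneg_left h h2).trans (le_of_eq ?_)
      ring

theorem integral_HH {c β : ℝ} (hb : 0 < β) (hc : β < c) (x₁ x₂ : ℝ) :
    ∫ v : ℝ × ℝ, HH c β x₁ x₂ v.1 (-v.2) =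
      (2 * Real.pi) ^ 2 * ((max (Real.exp x₁ - Real.exp x₂ - 1) 0 : ℝ) : ℂ) := by
  have hc0 : 0 < c := hb.trans hc
  have hre : ∀ w : ℝ, (c + w * I : ℂ).re = c := by simp
  rw [Measure.volume_eq_prod, integral_prod _ (integrable_HH hb hc x₁ x₂)]
  have hq : 0 < (1 + Real.exp x₂) * Real.exp (-x₁) := by positivity
  have hin : ∀ w : ℝ, ∫ t : ℝ, HH c β x₁ x₂ w (-t) =
      (2 * Real.pi * cexp x₁) * (((((1 + Real.exp x₂) * Real.exp (-x₁) : ℝ)) : ℂ) ^ (-(c + w * I : ℂ)) *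
        (1 / ((c + w * I) * (c + w * I + 1)))) := by
    intro w
    rw [integral_neg_eq_self (fun t : ℝ => HH c β x₁ x₂ w t)]
    unfold HH
    rw [integral_const_mul, inner_eq hb (by rw [hre]; exact hc)]
    have e : (((((1 + Real.exp x₂) * Real.exp (-x₁) : ℝ)) : ℂ) ^ (-(c + w * I : ℂ))) =
        Phi (c + w * I) (Real.exp x₂) * cexp ((c + w * I) * x₁) := by
      unfold Phi
      rw [ofReal_mul, mul_cpow_ofReal_nonneg (by positivity) (by positivity)]
      congr 1
      rw [cpow_def_of_ne_zero (by simp), ← ofReal_log (by positivity), Real.log_exp]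
      push_cast; ring_nf
    rw [e, add_mul _ 1, Complex.exp_add, one_mul]
    ring
  simp only [hin]
  rw [integral_const_mul, outer_eq hc0 hq, kk]
  have : Real.exp x₁ * max (1 - (1 + Real.exp x₂) * Real.exp (-x₁)) 0 =
      max (Real.exp x₁ - Real.exp x₂ - 1) 0 := by
    rw [mul_max_of_nonneg _ _ (Real.exp_pos _).le, mul_zero]
    congr 1
    rw [Real.exp_neg]; field_simp; ring
  rw [← this]
  push_cast
  ring

end SpreadAux

/-- **Theorem 1 (spread option payoff Fourier representation).**
For ε₂ > 0 and ε₁ + ε₂ < -1, the payoff `P(x) = (e^{x₁} - e^{x₂} - 1)⁺` equals the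
inverse Fourier integral of `P̂` along the shifted contour `ℝ² + iε`. -/
theorem spread_payoff_fourier_inversion
    (ε₁ ε₂ : ℝ) (hε₂ : 0 < ε₂) (hε : ε₁ + ε₂ < -1) (x₁ x₂ : ℝ) :
    ((max (Real.exp x₁ - Real.exp x₂ - 1) 0 : ℝ) : ℂ) =
      ((2 * Real.pi : ℂ) ^ 2)⁻¹ *
        ∫ v : ℝ × ℝ,
          Complex.exp (Complex.I *
              (((v.1 : ℂ) + Complex.I * (ε₁ : ℂ)) * (x₁ : ℂ) +
                ((v.2 : ℂ) + Complex.I * (ε₂ : ℂ)) * (x₂ : ℂ))) *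
            (Complex.Gamma
                (Complex.I *
                    (((v.1 : ℂ) + Complex.I * (ε₁ : ℂ)) + ((v.2 : ℂ) + Complex.I * (ε₂ : ℂ))) - 1) *
              Complex.Gamma (-Complex.I * ((v.2 : ℂ) + Complex.I * (ε₂ : ℂ))) /
              Complex.Gamma (Complex.I * ((v.1 : ℂ) + Complex.I * (ε₁ : ℂ)) + 1)) := by
  have hI : Complex.I ^ 2 = -1 := Complex.I_sq
  have hb := hε₂
  have hc : ε₂ < -1 - ε₁ := by linarith
  have hpi : (Real.pi : ℂ) ≠ 0 := by exact_mod_cast Real.pi_ne_zero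
  have key := SpreadAux.integral_HH hb hc x₁ x₂
  rw [eq_inv_mul_iff_mul_eq₀ (by simp [hpi]), ← key]
  congr 1
  ext v
  unfold SpreadAux.HH SpreadAux.BB
  set z : ℂ := ((-1 - ε₁ : ℝ) : ℂ) + v.1 * Complex.I with hz
  set b : ℂ := (ε₂ : ℂ) + ((-v.2 : ℝ) : ℂ) * Complex.I with hbd
  have hzre : 0 < z.re := by simp [hz]; linarith
  have hz0 : z ≠ 0 := by
    intro h; rw [h] at hzre; simp at hzre
  have hz1 : z + 1 ≠ 0 := by
    intro h; have := congrArg Complex.re h; simp at this; linarith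
  have e1 : Complex.I * (((v.1 : ℂ) + Complex.I * (ε₁ : ℂ)) + ((v.2 : ℂ) + Complex.I * (ε₂ : ℂ))) - 1
      = z - b := by
    rw [hz, hbd]; push_cast; linear_combination (ε₁ + ε₂ : ℂ) * hI
  have e2 : -Complex.I * ((v.2 : ℂ) + Complex.I * (ε₂ : ℂ)) = b := by
    rw [hbd]; push_cast; linear_combination (-ε₂ : ℂ) * hI
  have e3 : Complex.I * ((v.1 : ℂ) + Complex.I * (ε₁ : ℂ)) + 1 = z + 1 + 1 := by
    rw [hz]; push_cast; linear_combination (ε₁ : ℂ) * hI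
  have e4 : Complex.I * (((v.1 : ℂ) + Complex.I * (ε₁ : ℂ)) * (x₁ : ℂ) +
                ((v.2 : ℂ) + Complex.I * (ε₂ : ℂ)) * (x₂ : ℂ)) = (z + 1) * x₁ + -b * x₂ := by
    rw [hz, hbd]; push_cast; linear_combination (ε₁ * x₁ + ε₂ * x₂ : ℂ) * hI
  rw [e1, e2, e3, e4, Complex.exp_add, Complex.Gamma_add_one _ hz1, Complex.Gamma_add_one _ hz0]
  have hG : Complex.Gamma z ≠ 0 := Complex.Gamma_ne_zero_of_re_pos hzre
  field_simp
end

section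
/- Let Z₁, Z₂ be independent standard normal random variables, let ρ ∈ (-1,1), σ₁, σ₂ > 0, r ∈ ℝ, T > 0 and x₀ = (x₀₁, x₀₂) ∈ ℝ². Define W₁ = Z₁, W₂ = ρZ₁ + √(1-ρ²)·Z₂ and X_j = x₀_j + (r - σ_j²/2)T + σ_j√T·W_j for j = 1,2. Let ε = (ε₁, ε₂) be real numbers with ε₂ > 0 and ε₁ + ε₂ < -1. Then E[(e^{X₁} - e^{X₂} - 1)^+] = (2π)^{-2} ∫_{ℝ²} e^{i(u₁x₀₁ + u₂x₀₂)} · exp( i·(u₁(rT - σ₁²T/2) + u₂(rT - σ₂²T/2)) - T/2·(σ₁²u₁² + 2ρσ₁σ₂u₁u₂ + σ₂²u₂²) ) · P̂(u₁,u₂) dv₁ dv₂, where u₁ = v₁ + iε₁, u₂ = v₂ + iε₂ and the quadratic expressions in u₁, u₂ are evaluated with these complex arguments. -/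
open MeasureTheory ProbabilityTheory


theorem aux_beta (s t : ℂ) (hs : 0 < s.re) (ht : 0 < t.re) :
    Integrable (fun y : ℝ => Complex.exp (s * y - (s + t) * (Real.log (1 + Real.exp y) : ℝ))) ∧
    ∫ y : ℝ, Complex.exp (s * y - (s + t) * (Real.log (1 + Real.exp y) : ℝ)) =
      Complex.betaIntegral s t := by
  set G : ℝ → ℂ := fun x => (x : ℂ) ^ (s - 1) * (1 - (x : ℂ)) ^ (t - 1) with hG
  have himg : Set.image Real.sigmoid Set.univ = Set.Ioo 0 1 := by
    rw [Set.image_univ, Real.range_sigmoid]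
  have hd : ∀ x ∈ Set.univ, HasDerivWithinAt Real.sigmoid
      (Real.sigmoid x * (1 - Real.sigmoid x)) Set.univ x :=
    fun x _ => (Real.hasDerivAt_sigmoid x).hasDerivWithinAt
  have hinj : Set.InjOn Real.sigmoid Set.univ := Real.sigmoid_injective.injOn
  have key : ∀ y : ℝ, |Real.sigmoid y * (1 - Real.sigmoid y)| • G (Real.sigmoid y) =
      Complex.exp (s * y - (s + t) * (Real.log (1 + Real.exp y) : ℝ)) := by
    intro y
    have h1 := Real.sigmoid_pos y
    have h2 := sub_pos.2 (Real.sigmoid_lt_one y)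
    have hK : 0 < 1 + Real.exp y := by positivity
    have e1 : Real.sigmoid y = Real.exp (y - Real.log (1 + Real.exp y)) := by
      rw [Real.exp_sub, Real.exp_log hK, Real.sigmoid_def, Real.exp_neg]
      have := Real.exp_pos y
      field_simp
      ring
    have e2 : 1 - Real.sigmoid y = Real.exp (- Real.log (1 + Real.exp y)) := by
      rw [Real.exp_neg, Real.exp_log hK, Real.sigmoid_def, Real.exp_neg]
      have := Real.exp_pos y
      field_simp
      ring
    have e3 : (1 - (Real.sigmoid y : ℂ)) = ((Real.exp (- Real.log (1 + Real.exp y)) : ℝ) : ℂ) := by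
      rw [← e2]; push_cast; rfl
    rw [abs_of_pos (mul_pos h1 h2)]
    simp only [hG]
    rw [e3, e2, e1, Complex.real_smul]
    rw [Complex.cpow_def_of_ne_zero (by exact_mod_cast (Real.exp_pos _).ne'),
      Complex.cpow_def_of_ne_zero (by exact_mod_cast (Real.exp_pos _).ne'),
      ← Complex.ofReal_log (Real.exp_pos _).le, ← Complex.ofReal_log (Real.exp_pos _).le,
      Real.log_exp, Real.log_exp]
    rw [Complex.ofReal_mul, Complex.ofReal_exp, Complex.ofReal_exp, ← Complex.exp_add,
      ← Complex.exp_add, ← Complex.exp_add]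
    congr 1
    push_cast
    ring
  have hint : IntegrableOn G (Set.Ioo 0 1) := by
    have := Complex.betaIntegral_convergent hs ht
    rw [intervalIntegrable_iff_integrableOn_Ioo_of_le zero_le_one] at this
    exact this
  constructor
  · rw [← himg, integrableOn_image_iff_integrableOn_abs_deriv_smul MeasurableSet.univ hd hinj,
      integrableOn_univ] at hint
    exact hint.congr (Filter.Eventually.of_forall key)
  · rw [Complex.betaIntegral, intervalIntegral.integral_of_le zero_le_one,
      ← integral_Ioc_eq_integral_Ioo.symm, ← himg,
      integral_image_eq_integral_abs_deriv_smul MeasurableSet.univ hd hinj, setIntegral_univ]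
    exact (integral_congr_ae (Filter.Eventually.of_forall key)).symm

theorem aux_inner (a : ℂ) (ha : 1 < a.re) (L : ℝ) :
    Integrable (fun x : ℝ => Complex.exp (-a * x) * ((max (Real.exp x - Real.exp L) 0 : ℝ) : ℂ)) ∧
    ∫ x : ℝ, Complex.exp (-a * x) * ((max (Real.exp x - Real.exp L) 0 : ℝ) : ℂ) =
      Complex.exp ((1 - a) * L) / (a * (a - 1)) := by
  have h0 : a ≠ 0 := by rintro rfl; norm_num at ha
  have h1 : a - 1 ≠ 0 := by
    intro h
    have : a = 1 := sub_eq_zero.1 h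
    subst this; norm_num at ha
  have r1 : (1 - a).re < 0 := by simp; linarith
  have r2 : (-a).re < 0 := by simp; linarith
  have i1 := integrableOn_exp_mul_complex_Ioi r1 L
  have i2 := (integrableOn_exp_mul_complex_Ioi r2 L).const_mul (Complex.exp L)
  have e : (fun x : ℝ => Complex.exp (-a * x) * ((max (Real.exp x - Real.exp L) 0 : ℝ) : ℂ)) =
      (Set.Ioi L).indicator (fun x : ℝ => Complex.exp ((1 - a) * x) -
        Complex.exp L * Complex.exp (-a * x)) := by
    ext x
    by_cases hx : x ∈ Set.Ioi L
    · rw [Set.indicator_of_mem hx, max_eq_left (sub_nonneg.2 (Real.exp_le_exp.2 (le_of_lt hx)))]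
      push_cast
      rw [mul_sub, ← Complex.exp_add, mul_comm (Complex.exp L)]
      congr 2
      ring
    · rw [Set.indicator_of_notMem hx, max_eq_right]
      · simp
      · exact sub_nonpos.2 (Real.exp_le_exp.2 (not_lt.1 hx))
  rw [e]
  refine ⟨(integrable_indicator_iff measurableSet_Ioi).2 (i1.sub i2), ?_⟩
  rw [integral_indicator measurableSet_Ioi, integral_sub i1 i2, integral_const_mul,
    integral_exp_mul_complex_Ioi r1, integral_exp_mul_complex_Ioi r2]
  have : Complex.exp ((1 - a) * L) = Complex.exp L * Complex.exp (-a * L) := by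
    rw [← Complex.exp_add]; congr 1; ring
  rw [this]
  have h2 : (1 - a) ≠ 0 := by rw [← neg_sub]; exact neg_ne_zero.2 h1
  have : (1 - a) = -(a - 1) := by ring
  rw [this]
  field_simp
  ring

theorem aux_payoff (a s : ℂ) (hs : 0 < s.re) (ha : 1 + s.re < a.re) :
    Integrable (fun x : ℝ × ℝ => Complex.exp (-a * x.1 + s * x.2) *
      ((max (Real.exp x.1 - Real.exp x.2 - 1) 0 : ℝ) : ℂ)) ∧
    ∫ x : ℝ × ℝ, Complex.exp (-a * x.1 + s * x.2) *
      ((max (Real.exp x.1 - Real.exp x.2 - 1) 0 : ℝ) : ℂ) =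
      Complex.Gamma (a - s - 1) * Complex.Gamma s / Complex.Gamma (a + 1) := by
  -- inner facts
  have inner : ∀ (a s : ℂ) (_ : 0 < s.re) (_ : 1 + s.re < a.re) (y : ℝ),
      Integrable (fun x : ℝ => Complex.exp (-a * x + s * y) *
        ((max (Real.exp x - Real.exp y - 1) 0 : ℝ) : ℂ)) ∧
      ∫ x : ℝ, Complex.exp (-a * x + s * y) *
        ((max (Real.exp x - Real.exp y - 1) 0 : ℝ) : ℂ) =
      Complex.exp (s * y - (s + (a - s - 1)) * (Real.log (1 + Real.exp y) : ℝ)) *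
        (a * (a - 1))⁻¹ := by
    intro a s hs ha y
    obtain ⟨i, f⟩ := aux_inner a (by linarith) (Real.log (1 + Real.exp y))
    have hK : 0 < 1 + Real.exp y := by positivity
    have e : (fun x : ℝ => Complex.exp (-a * x + s * y) *
        ((max (Real.exp x - Real.exp y - 1) 0 : ℝ) : ℂ)) = fun x : ℝ =>
        Complex.exp (s * y) * (Complex.exp (-a * x) *
          ((max (Real.exp x - Real.exp (Real.log (1 + Real.exp y))) 0 : ℝ) : ℂ)) := by
      ext x
      rw [Real.exp_log hK, Complex.exp_add, sub_sub, add_comm (Real.exp y)]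
      ring
    rw [e]
    refine ⟨i.const_mul _, ?_⟩
    rw [integral_const_mul, f, div_eq_mul_inv, ← mul_assoc, ← Complex.exp_add]
    congr 2
    ring
  have hcont : Continuous (fun x : ℝ × ℝ => Complex.exp (-a * x.1 + s * x.2) *
      ((max (Real.exp x.1 - Real.exp x.2 - 1) 0 : ℝ) : ℂ)) := by fun_prop
  have hI : Integrable (fun x : ℝ × ℝ => Complex.exp (-a * x.1 + s * x.2) *
      ((max (Real.exp x.1 - Real.exp x.2 - 1) 0 : ℝ) : ℂ)) := by
    rw [Measure.volume_eq_prod, integrable_prod_iff' hcont.aestronglyMeasurable]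
    refine ⟨Filter.Eventually.of_forall fun y => (inner a s hs ha y).1, ?_⟩
    have hb := (aux_beta (s.re : ℂ) ((a.re : ℂ) - (s.re : ℂ) - 1) (by simpa using hs)
      (by simp; linarith)).1
    have hb2 := (hb.mul_const ((a.re : ℂ) * ((a.re : ℂ) - 1))⁻¹).re
    refine hb2.congr (Filter.Eventually.of_forall fun y => ?_)
    simp only
    rw [← (inner (a.re : ℂ) (s.re : ℂ) (by simpa using hs) (by simpa using ha) y).2]
    have : ∀ x : ℝ, Complex.exp (-(a.re : ℂ) * x + (s.re : ℂ) * y) *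
        ((max (Real.exp x - Real.exp y - 1) 0 : ℝ) : ℂ) =
        ((‖Complex.exp (-a * x + s * y) *
        ((max (Real.exp x - Real.exp y - 1) 0 : ℝ) : ℂ)‖ : ℝ) : ℂ) := by
      intro x
      rw [norm_mul, Complex.norm_exp, Complex.norm_real, Real.norm_of_nonneg (le_max_right _ _)]
      push_cast
      congr 2
      simp
    simp_rw [this]
    rw [integral_complex_ofReal]
    simp
  refine ⟨hI, ?_⟩
  rw [Measure.volume_eq_prod] at hI ⊢
  rw [integral_prod_symm _ hI]
  simp_rw [fun y => (inner a s hs ha y).2]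
  have hts : 0 < (a - s - 1).re := by simp; linarith
  rw [integral_mul_const, (aux_beta s (a - s - 1) hs hts).2]
  have hG := Complex.Gamma_mul_Gamma_eq_betaIntegral hs hts
  have h0 : a ≠ 0 := by rintro rfl; simp at ha; linarith
  have h1 : a - 1 ≠ 0 := by
    intro h
    have : a = 1 := sub_eq_zero.1 h
    subst this; simp at ha; linarith
  have hs2 : s + (a - s - 1) = a - 1 := by ring
  rw [hs2] at hG
  have hg : Complex.Gamma (a - 1) ≠ 0 := Complex.Gamma_ne_zero_of_re_pos (by simp; linarith)
  have g1 : Complex.Gamma a = (a - 1) * Complex.Gamma (a - 1) := by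
    have := Complex.Gamma_add_one (a - 1) h1
    rwa [sub_add_cancel] at this
  rw [Complex.Gamma_add_one a h0, g1, mul_comm (Complex.Gamma (a - s - 1)), hG]
  field_simp

theorem aux_gauss1 (σ : ℝ) (hσ : 0 < σ) (c d : ℂ) :
    ∫ x : ℝ, Complex.exp (-((σ : ℂ) ^ 2 / 2) * x ^ 2 + c * x + d) =
      ((Real.sqrt (2 * Real.pi) / σ : ℝ) : ℂ) * Complex.exp (d + c ^ 2 / (2 * σ ^ 2)) := by
  have hre : (-((σ : ℂ) ^ 2 / 2)).re < 0 := by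
    have : (-((σ : ℂ) ^ 2 / 2)) = ((-(σ ^ 2 / 2) : ℝ) : ℂ) := by push_cast; ring
    rw [this, Complex.ofReal_re]
    have : 0 < σ ^ 2 := by positivity
    linarith
  rw [integral_cexp_quadratic hre]
  have hσ' : (σ : ℂ) ≠ 0 := by exact_mod_cast hσ.ne'
  congr 1
  · have e : (Real.pi : ℂ) / -(-((σ : ℂ) ^ 2 / 2)) = ((2 * Real.pi / σ ^ 2 : ℝ) : ℂ) := by
      push_cast; field_simp
    have e2 : (1 / 2 : ℂ) = ((1 / 2 : ℝ) : ℂ) := by push_cast; rfl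
    rw [e, e2, ← Complex.ofReal_cpow (by positivity), ← Real.sqrt_eq_rpow,
      Real.sqrt_div (by positivity), Real.sqrt_sq hσ.le]
  · congr 1
    field_simp
    ring

noncomputable def auxPhi (a₁ a₂ s₁ s₂ ρ ε₁ ε₂ : ℝ) (v : ℝ × ℝ) : ℂ :=
  Complex.exp (Complex.I * (((v.1 : ℂ) + Complex.I * ε₁) * a₁ + ((v.2 : ℂ) + Complex.I * ε₂) * a₂) -
    1 / 2 * ((s₁ : ℂ) ^ 2 * ((v.1 : ℂ) + Complex.I * ε₁) ^ 2 +
      2 * ρ * s₁ * s₂ * ((v.1 : ℂ) + Complex.I * ε₁) * ((v.2 : ℂ) + Complex.I * ε₂) +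
      (s₂ : ℂ) ^ 2 * ((v.2 : ℂ) + Complex.I * ε₂) ^ 2))

theorem aux_phi_int (a₁ a₂ s₁ s₂ ρ ε₁ ε₂ : ℝ) (hs₁ : 0 < s₁) (hs₂ : 0 < s₂)
    (hρ₁ : -1 < ρ) (hρ₂ : ρ < 1) :
    Integrable (auxPhi a₁ a₂ s₁ s₂ ρ ε₁ ε₂) := by
  obtain ⟨k, hk, hk1, hk2⟩ : ∃ k : ℝ, 0 < k ∧ k ≤ 1 - ρ ∧ k ≤ 1 + ρ :=
    ⟨min (1 - ρ) (1 + ρ), by apply lt_min <;> linarith, min_le_left _ _, min_le_right _ _⟩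
  set C : ℝ := -(ε₁ * a₁ + ε₂ * a₂) + 1 / 2 * (s₁ ^ 2 * ε₁ ^ 2 + 2 * ρ * s₁ * s₂ * ε₁ * ε₂ +
    s₂ ^ 2 * ε₂ ^ 2) with hC
  have g1 := integrable_exp_neg_mul_sq (b := k * s₁ ^ 2 / 2) (by positivity)
  have g2 := integrable_exp_neg_mul_sq (b := k * s₂ ^ 2 / 2) (by positivity)
  have g := (g1.mul_prod g2).const_mul (Real.exp C)
  rw [← Measure.volume_eq_prod] at g
  refine g.mono' ?_ (Filter.Eventually.of_forall fun v => ?_)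
  · apply Continuous.aestronglyMeasurable
    unfold auxPhi
    fun_prop
  · unfold auxPhi
    rw [Complex.norm_exp, ← Real.exp_add, ← Real.exp_add]
    apply Real.exp_le_exp.2
    have : (Complex.I * (((v.1 : ℂ) + Complex.I * ε₁) * a₁ + ((v.2 : ℂ) + Complex.I * ε₂) * a₂) -
      1 / 2 * ((s₁ : ℂ) ^ 2 * ((v.1 : ℂ) + Complex.I * ε₁) ^ 2 +
      2 * ρ * s₁ * s₂ * ((v.1 : ℂ) + Complex.I * ε₁) * ((v.2 : ℂ) + Complex.I * ε₂) +
      (s₂ : ℂ) ^ 2 * ((v.2 : ℂ) + Complex.I * ε₂) ^ 2)) =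
      ((C - 1 / 2 * (s₁ ^ 2 * v.1 ^ 2 + 2 * ρ * s₁ * s₂ * v.1 * v.2 + s₂ ^ 2 * v.2 ^ 2) : ℝ) : ℂ) +
      ((v.1 * a₁ + v.2 * a₂ - (s₁ ^ 2 * v.1 * ε₁ + ρ * s₁ * s₂ * (v.1 * ε₂ + v.2 * ε₁) +
        s₂ ^ 2 * v.2 * ε₂) : ℝ) : ℂ) * Complex.I := by
      rw [hC]
      push_cast
      linear_combination ((ε₁ : ℂ) * a₁ + ε₂ * a₂ - 1 / 2 * ((s₁ : ℂ) ^ 2 * ε₁ ^ 2 +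
        2 * ρ * s₁ * s₂ * ε₁ * ε₂ + (s₂ : ℂ) ^ 2 * ε₂ ^ 2)) * Complex.I_sq
    rw [this, Complex.add_re, Complex.ofReal_re, Complex.re_ofReal_mul, Complex.I_re, mul_zero,
      add_zero]
    nlinarith [mul_nonneg (sub_nonneg.2 hk1) (sq_nonneg (s₁ * v.1 - s₂ * v.2)),
      mul_nonneg (sub_nonneg.2 hk2) (sq_nonneg (s₁ * v.1 + s₂ * v.2))]

theorem aux_phi_inv (a₁ a₂ s₁ s₂ ρ c ε₁ ε₂ : ℝ) (hs₁ : 0 < s₁) (hs₂ : 0 < s₂)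
    (hρ₁ : -1 < ρ) (hρ₂ : ρ < 1) (hc : 0 < c) (hc2 : c ^ 2 = 1 - ρ ^ 2) (x₁ x₂ : ℝ) :
    ∫ v : ℝ × ℝ, Complex.exp (-(Complex.I * (v.1 * x₁ + v.2 * x₂))) *
      auxPhi a₁ a₂ s₁ s₂ ρ ε₁ ε₂ v =
    ((2 * Real.pi / (s₁ * s₂ * c) * Real.exp (-(ε₁ * x₁ + ε₂ * x₂)) *
      Real.exp (-(((x₁ - a₁) / s₁) ^ 2 / 2) -
        (((x₂ - a₂) / s₂ - ρ * ((x₁ - a₁) / s₁)) / c) ^ 2 / 2) : ℝ) : ℂ) := by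
  have hI : Integrable (fun v : ℝ × ℝ => Complex.exp (-(Complex.I * (v.1 * x₁ + v.2 * x₂))) *
      auxPhi a₁ a₂ s₁ s₂ ρ ε₁ ε₂ v) := by
    refine (aux_phi_int a₁ a₂ s₁ s₂ ρ ε₁ ε₂ hs₁ hs₂ hρ₁ hρ₂).bdd_mul (c := 1) ?_ ?_
    · apply Continuous.aestronglyMeasurable
      fun_prop
    · refine Filter.Eventually.of_forall fun v => ?_
      rw [Complex.norm_exp]
      simp
  rw [Measure.volume_eq_prod] at hI ⊢
  rw [integral_prod_symm _ hI]
  have hs₁' : (s₁ : ℂ) ≠ 0 := by exact_mod_cast hs₁.ne'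
  have hs₂' : (s₂ : ℂ) ≠ 0 := by exact_mod_cast hs₂.ne'
  have hc' : (c : ℂ) ≠ 0 := by exact_mod_cast hc.ne'
  have hc2' : (ρ : ℂ) ^ 2 = 1 - (c : ℂ) ^ 2 := by
    have : ρ ^ 2 = 1 - c ^ 2 := by linarith
    exact_mod_cast this
  have inner : ∀ y : ℝ, ∫ x : ℝ, Complex.exp (-(Complex.I * ((x : ℂ) * x₁ + (y : ℂ) * x₂))) *
      auxPhi a₁ a₂ s₁ s₂ ρ ε₁ ε₂ (x, y) =
      ((Real.sqrt (2 * Real.pi) / s₁ : ℝ) : ℂ) *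
        Complex.exp (-(((s₂ * c : ℝ) : ℂ) ^ 2 / 2) * y ^ 2 +
          (Complex.I * ((a₂ - x₂) - ρ * s₂ * (a₁ - x₁) / s₁) - (s₂ * c) ^ 2 * Complex.I * ε₂) * y +
          (-(ε₁ * x₁ + ε₂ * x₂) - ε₂ * ((a₂ - x₂) - ρ * s₂ * (a₁ - x₁) / s₁) +
            (s₂ * c) ^ 2 * ε₂ ^ 2 / 2 - (a₁ - x₁) ^ 2 / (2 * s₁ ^ 2))) := by
    intro y
    have e : ∀ x : ℝ, Complex.exp (-(Complex.I * ((x : ℂ) * x₁ + (y : ℂ) * x₂))) *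
      auxPhi a₁ a₂ s₁ s₂ ρ ε₁ ε₂ (x, y) =
      Complex.exp (-((s₁ : ℂ) ^ 2 / 2) * x ^ 2 +
        (Complex.I * (a₁ - x₁) - s₁ ^ 2 * Complex.I * ε₁ -
          ρ * s₁ * s₂ * ((y : ℂ) + Complex.I * ε₂)) * x +
        (-(Complex.I * (y * x₂)) + Complex.I * ((Complex.I * ε₁) * a₁ + (y + Complex.I * ε₂) * a₂) -
          1 / 2 * ((s₁ : ℂ) ^ 2 * (Complex.I * ε₁) ^ 2 +
      2 * ρ * s₁ * s₂ * (Complex.I * ε₁) * (y + Complex.I * ε₂) +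
      (s₂ : ℂ) ^ 2 * (y + Complex.I * ε₂) ^ 2))) := by
      intro x
      unfold auxPhi
      rw [← Complex.exp_add]
      congr 1
      ring
    simp_rw [e]
    rw [aux_gauss1 s₁ hs₁]
    congr 2
    push_cast
    have : (c : ℂ) ^ 2 = 1 - (ρ : ℂ) ^ 2 := by rw [hc2']; ring
    simp only [mul_pow, this]
    field_simp
    ring_nf
    simp only [Complex.I_sq]
    ring
  simp_rw [inner]
  rw [integral_const_mul, aux_gauss1 (s₂ * c) (by positivity), ← mul_assoc, ← Complex.ofReal_mul]
  rw [mul_assoc (2 * Real.pi / (s₁ * s₂ * c)), Complex.ofReal_mul (2 * Real.pi / (s₁ * s₂ * c))]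
  congr 1
  · congr 1
    have := Real.mul_self_sqrt (show 0 ≤ 2 * Real.pi by positivity)
    field_simp
    nlinarith
  · rw [← Real.exp_add, Complex.ofReal_exp]
    congr 1
    push_cast
    field_simp
    ring_nf
    simp only [Complex.I_sq]
    ring

theorem aux_density (a₁ a₂ s₁ s₂ ρ c : ℝ) (hs₁ : 0 < s₁) (hs₂ : 0 < s₂) (hc : 0 < c)
    (P : ℝ × ℝ → ℝ) :
    ∫ z : ℝ × ℝ, P (a₁ + s₁ * z.1, a₂ + s₂ * (ρ * z.1 + c * z.2))
        ∂((gaussianReal 0 1).prod (gaussianReal 0 1)) =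
    ∫ x : ℝ × ℝ, P x * ((2 * Real.pi * (s₁ * s₂ * c))⁻¹ *
      Real.exp (-(((x.1 - a₁) / s₁) ^ 2 / 2) -
        (((x.2 - a₂) / s₂ - ρ * ((x.1 - a₁) / s₁)) / c) ^ 2 / 2)) := by
  set f : ℝ × ℝ → ℝ × ℝ := fun z => (a₁ + s₁ * z.1, a₂ + s₂ * (ρ * z.1 + c * z.2)) with hf
  set f' : ℝ × ℝ →L[ℝ] ℝ × ℝ := (Matrix.toLin (.finTwoProd ℝ) (.finTwoProd ℝ)
    !![s₁, 0; s₂ * ρ, s₂ * c]).toContinuousLinearMap with hf'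
  have hdet : f'.det = s₁ * s₂ * c := by
    rw [hf']
    simp only [LinearMap.det_toContinuousLinearMap, LinearMap.det_toLin, Matrix.det_fin_two_of]
    ring
  have hd : ∀ z ∈ Set.univ, HasFDerivWithinAt f f' Set.univ z := by
    intro z _
    apply HasFDerivAt.hasFDerivWithinAt
    have e : f = fun z => (a₁, a₂) + f' z := by
      ext z <;> simp [hf, hf', Matrix.toLin_finTwoProd_toContinuousLinearMap] <;> ring
    rw [e]
    exact f'.hasFDerivAt.const_add _
  have hinj : Function.Injective f := by
    rintro ⟨x, y⟩ ⟨x', y'⟩ h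
    simp only [hf, Prod.mk.injEq] at h
    have h1 : x = x' := by
      have := h.1
      have h3 : s₁ * x = s₁ * x' := by linarith
      exact mul_left_cancel₀ hs₁.ne' h3
    subst h1
    have h3 : s₂ * (ρ * x + c * y) = s₂ * (ρ * x + c * y') := by linarith [h.2]
    have h4 := mul_left_cancel₀ hs₂.ne' h3
    have h5 : c * y = c * y' := by linarith
    rw [mul_left_cancel₀ hc.ne' h5]
  have hsurj : Function.Surjective f := by
    rintro ⟨x, y⟩
    refine ⟨((x - a₁) / s₁, ((y - a₂) / s₂ - ρ * ((x - a₁) / s₁)) / c), ?_⟩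
    simp only [hf, Prod.mk.injEq]
    constructor
    · field_simp; ring
    · field_simp; ring
  have himg : Set.image f Set.univ = Set.univ := by rw [Set.image_univ]; exact hsurj.range_eq
  have key := integral_image_eq_integral_abs_det_fderiv_smul volume MeasurableSet.univ hd
    hinj.injOn (fun x : ℝ × ℝ => P x * ((2 * Real.pi * (s₁ * s₂ * c))⁻¹ *
      Real.exp (-(((x.1 - a₁) / s₁) ^ 2 / 2) -
        (((x.2 - a₂) / s₂ - ρ * ((x.1 - a₁) / s₁)) / c) ^ 2 / 2)))
  rw [himg, setIntegral_univ, setIntegral_univ] at key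
  rw [key]
  rw [gaussianReal_of_var_ne_zero 0 one_ne_zero,
    prod_withDensity (measurable_gaussianPDF _ _) (measurable_gaussianPDF _ _),
    integral_withDensity_eq_integral_toReal_smul (by fun_prop)
      (Filter.Eventually.of_forall fun z => ENNReal.mul_lt_top gaussianPDF_lt_top gaussianPDF_lt_top),
    ← Measure.volume_eq_prod]
  congr 1
  ext z
  rw [hdet, abs_of_pos (by positivity), ENNReal.toReal_mul, toReal_gaussianPDF, toReal_gaussianPDF]
  simp only [smul_eq_mul, hf, gaussianPDFReal]
  have e1 : (a₁ + s₁ * z.1 - a₁) / s₁ = z.1 := by field_simp; ring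
  have e2 : ((a₂ + s₂ * (ρ * z.1 + c * z.2) - a₂) / s₂ - ρ * z.1) / c = z.2 := by
    field_simp; ring
  rw [e1, e2, sub_eq_add_neg (-(z.1 ^ 2 / 2)), Real.exp_add]
  have hs := Real.mul_self_sqrt (show 0 ≤ 2 * Real.pi by positivity)
  have hsp : 0 < Real.sqrt (2 * Real.pi) := by positivity
  simp only [NNReal.coe_one, mul_one, sub_zero]
  rw [neg_div, neg_div]
  have : (2 * Real.pi * (s₁ * s₂ * c))⁻¹ = (√(2 * Real.pi))⁻¹ * (√(2 * Real.pi))⁻¹ * (s₁ * s₂ * c)⁻¹ := by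
    rw [← mul_inv, hs, ← mul_inv]
  rw [this]
  field_simp

theorem aux_main (a₁ a₂ s₁ s₂ ρ c ε₁ ε₂ : ℝ) (hs₁ : 0 < s₁) (hs₂ : 0 < s₂)
    (hρ₁ : -1 < ρ) (hρ₂ : ρ < 1) (hc : 0 < c) (hc2 : c ^ 2 = 1 - ρ ^ 2)
    (hε₂ : 0 < ε₂) (hε : ε₁ + ε₂ < -1) :
    ((∫ z : ℝ × ℝ, max (Real.exp (a₁ + s₁ * z.1) - Real.exp (a₂ + s₂ * (ρ * z.1 + c * z.2)) - 1) 0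
        ∂((gaussianReal 0 1).prod (gaussianReal 0 1)) : ℝ) : ℂ) =
    ((2 * Real.pi : ℂ) ^ 2)⁻¹ * ∫ v : ℝ × ℝ, auxPhi a₁ a₂ s₁ s₂ ρ ε₁ ε₂ v *
      (Complex.Gamma
                (Complex.I *
                    (((v.1 : ℂ) + Complex.I * (ε₁ : ℂ)) +
                      ((v.2 : ℂ) + Complex.I * (ε₂ : ℂ))) - 1) *
              Complex.Gamma (-Complex.I * ((v.2 : ℂ) + Complex.I * (ε₂ : ℂ))) /
              Complex.Gamma (Complex.I * ((v.1 : ℂ) + Complex.I * (ε₁ : ℂ)) + 1)) := by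
  have hA := aux_density a₁ a₂ s₁ s₂ ρ c hs₁ hs₂ hc
    (fun x => max (Real.exp x.1 - Real.exp x.2 - 1) 0)
  simp only at hA
  rw [hA, ← integral_complex_ofReal, ← integral_const_mul]
  set g : ℝ × ℝ → ℂ := fun x => Complex.exp (-((-ε₁ : ℝ) : ℂ) * x.1 + (ε₂ : ℂ) * x.2) *
      ((max (Real.exp x.1 - Real.exp x.2 - 1) 0 : ℝ) : ℂ) with hg
  have hgi : Integrable g := (aux_payoff ((-ε₁ : ℝ) : ℂ) (ε₂ : ℂ) (by simpa using hε₂)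
    (by simp only [Complex.ofReal_re]; linarith)).1
  have hphi := aux_phi_int a₁ a₂ s₁ s₂ ρ ε₁ ε₂ hs₁ hs₂ hρ₁ hρ₂
  set F : ℝ × ℝ → ℝ × ℝ → ℂ := fun x v => Complex.exp (-(Complex.I * (v.1 * x.1 + v.2 * x.2))) *
    (g x * auxPhi a₁ a₂ s₁ s₂ ρ ε₁ ε₂ v) with hF
  have hFi : Integrable (Function.uncurry F) (volume.prod volume) := by
    refine (hgi.mul_prod hphi).bdd_mul (c := 1)
      (f := fun p : (ℝ × ℝ) × (ℝ × ℝ) =>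
        Complex.exp (-(Complex.I * (p.2.1 * p.1.1 + p.2.2 * p.1.2)))) ?_ ?_
    · apply Continuous.aestronglyMeasurable
      fun_prop
    · refine Filter.Eventually.of_forall fun v => ?_
      rw [Complex.norm_exp]
      simp
  have hswap := integral_integral_swap hFi
  have hpi : (Real.pi : ℂ) ≠ 0 := by exact_mod_cast Real.pi_ne_zero
  have hs₁' : (s₁ : ℂ) ≠ 0 := by exact_mod_cast hs₁.ne'
  have hs₂' : (s₂ : ℂ) ≠ 0 := by exact_mod_cast hs₂.ne'
  have hc' : (c : ℂ) ≠ 0 := by exact_mod_cast hc.ne'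
  have hL : ∀ x : ℝ × ℝ, ((max (Real.exp x.1 - Real.exp x.2 - 1) 0 *
      ((2 * Real.pi * (s₁ * s₂ * c))⁻¹ *
      Real.exp (-(((x.1 - a₁) / s₁) ^ 2 / 2) -
        (((x.2 - a₂) / s₂ - ρ * ((x.1 - a₁) / s₁)) / c) ^ 2 / 2)) : ℝ) : ℂ) =
      ((2 * Real.pi : ℂ) ^ 2)⁻¹ * ∫ v, F x v := by
    intro x
    have e : ∀ v : ℝ × ℝ, F x v = g x * (Complex.exp (-(Complex.I * (v.1 * x.1 + v.2 * x.2))) *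
      auxPhi a₁ a₂ s₁ s₂ ρ ε₁ ε₂ v) := by
      intro v; simp only [hF]; ring
    simp_rw [e]
    rw [integral_const_mul, aux_phi_inv a₁ a₂ s₁ s₂ ρ c ε₁ ε₂ hs₁ hs₂ hρ₁ hρ₂ hc hc2]
    have e2 : g x = ((Real.exp (ε₁ * x.1 + ε₂ * x.2) : ℝ) : ℂ) *
        ((max (Real.exp x.1 - Real.exp x.2 - 1) 0 : ℝ) : ℂ) := by
      simp only [hg]
      push_cast
      rw [neg_neg]
    rw [e2, Real.exp_neg (ε₁ * x.1 + ε₂ * x.2)]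
    have h3 : ((Real.exp (ε₁ * x.1 + ε₂ * x.2) : ℝ) : ℂ) ≠ 0 := by
      exact_mod_cast (Real.exp_pos _).ne'
    generalize Real.exp (ε₁ * x.1 + ε₂ * x.2) = A at h3 ⊢
    generalize max (Real.exp x.1 - Real.exp x.2 - 1) 0 = B
    generalize Real.exp _ = D
    push_cast
    field_simp
  simp_rw [hL]
  rw [integral_const_mul, hswap, ← integral_const_mul]
  congr 1
  ext v
  congr 1
  have e : ∀ x : ℝ × ℝ, F x v = auxPhi a₁ a₂ s₁ s₂ ρ ε₁ ε₂ v *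
      (Complex.exp (-(Complex.I * ((v.1 : ℂ) + Complex.I * ε₁)) * x.1 +
        (-Complex.I * ((v.2 : ℂ) + Complex.I * ε₂)) * x.2) *
      ((max (Real.exp x.1 - Real.exp x.2 - 1) 0 : ℝ) : ℂ)) := by
    intro x
    have : Complex.exp (-(Complex.I * ((v.1 : ℂ) + Complex.I * ε₁)) * x.1 +
        (-Complex.I * ((v.2 : ℂ) + Complex.I * ε₂)) * x.2) =
        Complex.exp (-(Complex.I * (v.1 * x.1 + v.2 * x.2))) *
        Complex.exp (-((-ε₁ : ℝ) : ℂ) * x.1 + (ε₂ : ℂ) * x.2) := by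
      rw [← Complex.exp_add]
      congr 1
      push_cast
      linear_combination (-(ε₁ : ℂ) * x.1 - ε₂ * x.2) * Complex.I_sq
    rw [this]
    simp only [hF, hg]
    ring
  simp_rw [e]
  rw [integral_const_mul, (aux_payoff (Complex.I * ((v.1 : ℂ) + Complex.I * ε₁))
    (-Complex.I * ((v.2 : ℂ) + Complex.I * ε₂)) (by simpa using hε₂) (by simp; linarith)).2]
  congr 4
  ring

/-- **GBM spread option FFT pricing formula.** With `(Z₁, Z₂)` independent standard
normals, `W₁ = Z₁`, `W₂ = ρZ₁ + √(1-ρ²)Z₂`, `X_j = x₀_j + (r - σ_j²/2)T + σ_j√T W_j`,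
and ε₂ > 0, ε₁ + ε₂ < -1, the expected spread payoff `E[(e^{X₁} - e^{X₂} - 1)⁺]` equals
the contour integral of the Gaussian characteristic function against `P̂`. -/
theorem gbm_spread_option_formula
    (ρ σ₁ σ₂ r T x₀₁ x₀₂ : ℝ) (hρ₁ : -1 < ρ) (hρ₂ : ρ < 1)
    (hσ₁ : 0 < σ₁) (hσ₂ : 0 < σ₂) (hT : 0 < T)
    (ε₁ ε₂ : ℝ) (hε₂ : 0 < ε₂) (hε : ε₁ + ε₂ < -1) :
    ((∫ z : ℝ × ℝ,
        max (Real.exp (x₀₁ + (r - σ₁ ^ 2 / 2) * T + σ₁ * Real.sqrt T * z.1) -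
            Real.exp (x₀₂ + (r - σ₂ ^ 2 / 2) * T +
              σ₂ * Real.sqrt T * (ρ * z.1 + Real.sqrt (1 - ρ ^ 2) * z.2)) - 1) 0
        ∂((gaussianReal 0 1).prod (gaussianReal 0 1)) : ℝ) : ℂ) =
      ((2 * Real.pi : ℂ) ^ 2)⁻¹ *
        ∫ v : ℝ × ℝ,
          Complex.exp (Complex.I *
              (((v.1 : ℂ) + Complex.I * (ε₁ : ℂ)) * (x₀₁ : ℂ) +
                ((v.2 : ℂ) + Complex.I * (ε₂ : ℂ)) * (x₀₂ : ℂ))) *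
            Complex.exp
              (Complex.I *
                  (((v.1 : ℂ) + Complex.I * (ε₁ : ℂ)) * ((r * T - σ₁ ^ 2 * T / 2 : ℝ) : ℂ) +
                    ((v.2 : ℂ) + Complex.I * (ε₂ : ℂ)) * ((r * T - σ₂ ^ 2 * T / 2 : ℝ) : ℂ)) -
                (T : ℂ) / 2 *
                  ((σ₁ : ℂ) ^ 2 * ((v.1 : ℂ) + Complex.I * (ε₁ : ℂ)) ^ 2 +
                    2 * (ρ : ℂ) * (σ₁ : ℂ) * (σ₂ : ℂ) *
                      ((v.1 : ℂ) + Complex.I * (ε₁ : ℂ)) *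
                      ((v.2 : ℂ) + Complex.I * (ε₂ : ℂ)) +
                    (σ₂ : ℂ) ^ 2 * ((v.2 : ℂ) + Complex.I * (ε₂ : ℂ)) ^ 2)) *
            (Complex.Gamma
                (Complex.I *
                    (((v.1 : ℂ) + Complex.I * (ε₁ : ℂ)) +
                      ((v.2 : ℂ) + Complex.I * (ε₂ : ℂ))) - 1) *
              Complex.Gamma (-Complex.I * ((v.2 : ℂ) + Complex.I * (ε₂ : ℂ))) /
              Complex.Gamma (Complex.I * ((v.1 : ℂ) + Complex.I * (ε₁ : ℂ)) + 1)) := by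
  have hc : 0 < 1 - ρ ^ 2 := by nlinarith
  have h := aux_main (x₀₁ + (r - σ₁ ^ 2 / 2) * T) (x₀₂ + (r - σ₂ ^ 2 / 2) * T)
    (σ₁ * Real.sqrt T) (σ₂ * Real.sqrt T) ρ (Real.sqrt (1 - ρ ^ 2)) ε₁ ε₂ (by positivity)
    (by positivity) hρ₁ hρ₂ (Real.sqrt_pos.2 hc) (Real.sq_sqrt hc.le) hε₂ hε
  rw [h]
  congr 2
  ext v
  congr 1
  unfold auxPhi
  rw [← Complex.exp_add]
  congr 1
  have hT2 : ((Real.sqrt T : ℝ) : ℂ) ^ 2 = (T : ℂ) := by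
    exact_mod_cast Real.sq_sqrt hT.le
  rw [← hT2]
  push_cast
  rw [← hT2]
  ring
end
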